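/- arXiv:1902.11181 — 3 statements merged into one kernel-verified Lean document; each statement's English description precedes it below -/
import Mathlib

section
/- Let A be an n×m real matrix with AᵀA = I_m, and let C be an n×n symmetric positive definite real matrix. Then AᵀCA is positive definite (hence invertible) and the matrix C⁻¹ − A·(AᵀCA)⁻¹·Aᵀ is positive semidefinite. -/
open Matrix

theorem Matrix.PosDef.posSemidef_inv_sub_mul_inv_mul {m n : Type*} [Fintype m] [DecidableEq m]
    [Fintype n] [DecidableEq n] {C : Matrix n n ℝ} (hC : C.PosDef) {A : Matrix n m ℝ}
    (hK : (Aᵀ * C * A).PosDef) : (C⁻¹ - A * (Aᵀ * C * A)⁻¹ * Aᵀ).PosSemidef := by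
  set K := Aᵀ * C * A with hK_def
  set P := A * K⁻¹ * Aᵀ with hP_def
  have hC_unit : IsUnit C.det := (isUnit_iff_isUnit_det C).mp hC.isUnit
  have hK_unit : IsUnit K.det := (isUnit_iff_isUnit_det K).mp hK.isUnit
  have hP_symm : Pᴴ = P := by
    rw [hP_def, ← conjTranspose_eq_transpose_of_trivial A]
    exact isHermitian_mul_mul_conjTranspose A hK.inv.isHermitian
  have hPCP : P * C * P = P := by
    calc P * C * P = A * (K⁻¹ * K) * K⁻¹ * Aᵀ := by
          simp only [hP_def, hK_def, Matrix.mul_assoc]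
      _ = P := by rw [nonsing_inv_mul K hK_unit, Matrix.mul_one]
  have h_eq : (C⁻¹ - P)ᴴ * C * (C⁻¹ - P) = C⁻¹ - P := by
    rw [conjTranspose_sub, hP_symm, hC.inv.isHermitian.eq, Matrix.sub_mul,
      nonsing_inv_mul C hC_unit, Matrix.mul_sub, Matrix.sub_mul, Matrix.sub_mul, hPCP,
      Matrix.mul_assoc P, mul_nonsing_inv C hC_unit]
    simp
  rw [← h_eq]
  exact hC.posSemidef.conjTranspose_mul_mul_same _

/-- Lemma D.3: if `AᵀA = I` and `C` is symmetric positive definite, then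
`AᵀCA` is positive definite and `C⁻¹ − A(AᵀCA)⁻¹Aᵀ` is positive semidefinite. -/
theorem inv_sub_compression_posSemidef {n m : ℕ}
    (A : Matrix (Fin n) (Fin m) ℝ) (hA : Aᵀ * A = 1)
    (C : Matrix (Fin n) (Fin n) ℝ) (hC : C.PosDef) :
    (Aᵀ * C * A).PosDef ∧ (C⁻¹ - A * (Aᵀ * C * A)⁻¹ * Aᵀ).PosSemidef := by
  have hA_inj : Function.Injective A.mulVec :=
    Function.LeftInverse.injective (g := Aᵀ.mulVec) fun x => by simp [hA]
  have hK : (Aᵀ * C * A).PosDef := by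
    simpa using hC.conjTranspose_mul_mul_same hA_inj
  exact ⟨hK, hC.posSemidef_inv_sub_mul_inv_mul hK⟩
end

section
/- Let ς : ℤ → ℝ satisfy ς(−h) = ς(h) for all h and Σ_{h=1}^{∞} h·|ς(h)| < ∞, and define g : ℝ → ℝ by g(ω) := (1/(2π))·Σ_{h∈ℤ} ς(h)·cos(hω) (the series converges absolutely). For each odd integer T = 2m+1 ≥ 3 write ω_j := 2πj/T, and define: the T×T Toeplitz matrix C_T with (t,s) entry ς(t−s); the T×T orthogonal matrix P_T whose row 0 is (1/√T)·(1, …, 1) and whose rows 2j−1 and 2j (for j = 1, …, m) are √(2/T)·(cos(0·ω_j), cos(1·ω_j), …, cos((T−1)·ω_j)) and √(2/T)·(sin(0·ω_j), sin(1·ω_j), …, sin((T−1)·ω_j)) respectively; and the T×T diagonal matrix G_T with diagonal (g(0), g(ω_1), g(ω_1), …, g(ω_m), g(ω_m)). Then there exists a constant K, depending only on ς, such that for every odd T ≥ 3 and all indices p, q ∈ {1, …, T}: |(P_T·C_T·P_Tᵀ − 2π·G_T)_{pq}| ≤ K/T. -/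
open Matrix

/-- The spectral density `g(ω) = (1/2π) Σ_{h ∈ ℤ} ς(h) cos(hω)` associated with the
autocovariance sequence `ς`. -/
noncomputable def specDensity (ς : ℤ → ℝ) (ω : ℝ) : ℝ :=
  (1 / (2 * Real.pi)) * ∑' h : ℤ, ς h * Real.cos ((h : ℝ) * ω)

/-- The `T×T` Toeplitz matrix with `(t,s)` entry `ς(t−s)`, for `T = 2m+1`. -/
noncomputable def toeplitzMat (ς : ℤ → ℝ) (m : ℕ) :
    Matrix (Fin (2 * m + 1)) (Fin (2 * m + 1)) ℝ :=
  fun t s => ς ((t.val : ℤ) - (s.val : ℤ))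

/-- The `T×T` orthogonal matrix of the discrete real trigonometric basis, for `T = 2m+1`:
row `0` is `(1/√T)(1,…,1)`; rows `2j−1` and `2j` (for `j = 1,…,m`) are
`√(2/T)·(cos(k·ω_j))_{k=0}^{T−1}` and `√(2/T)·(sin(k·ω_j))_{k=0}^{T−1}` with `ω_j = 2πj/T`. -/
noncomputable def trigBasisMat (m : ℕ) :
    Matrix (Fin (2 * m + 1)) (Fin (2 * m + 1)) ℝ :=
  fun t s =>
    if t.val = 0 then Real.sqrt (1 / (2 * m + 1))
    else if t.val % 2 = 1 then
      Real.sqrt (2 / (2 * m + 1)) *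
        Real.cos ((s.val : ℝ) * (2 * Real.pi * (((t.val + 1) / 2 : ℕ) : ℝ) / (2 * m + 1)))
    else
      Real.sqrt (2 / (2 * m + 1)) *
        Real.sin ((s.val : ℝ) * (2 * Real.pi * ((t.val / 2 : ℕ) : ℝ) / (2 * m + 1)))

/-- The `T×T` diagonal matrix `diag(g(0), g(ω_1), g(ω_1), …, g(ω_m), g(ω_m))` of spectral
density values at the Fourier frequencies `ω_j = 2πj/T`, `T = 2m+1`. -/
noncomputable def specDiagMat (ς : ℤ → ℝ) (m : ℕ) :
    Matrix (Fin (2 * m + 1)) (Fin (2 * m + 1)) ℝ :=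
  Matrix.diagonal (fun t =>
    specDensity ς (2 * Real.pi * ((((t.val + 1) / 2 : ℕ)) : ℝ) / (2 * m + 1)))

lemma summable_int_abs_mul_of_even {ς : ℤ → ℝ} (heven : ∀ h : ℤ, ς (-h) = ς h)
    (hsum : Summable (fun h : ℕ => (h : ℝ) * |ς (h : ℤ)|)) :
    Summable (fun h : ℤ => |(h : ℝ)| * |ς h|) := by
  refine Summable.of_nat_of_neg ?_ ?_ <;> simpa [heven] using hsum

lemma summable_abs_of_summable_abs_mul {ς : ℤ → ℝ}
    (hsum : Summable (fun h : ℤ => |(h : ℝ)| * |ς h|)) : Summable (fun h : ℤ => |ς h|) := by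
  refine Summable.of_norm_bounded_eventually hsum ?_
  refine (Set.finite_singleton (0 : ℤ)).subset fun h hh => ?_
  by_contra h0
  refine hh ?_
  have h1 : (1 : ℝ) ≤ |(h : ℝ)| := by exact_mod_cast Int.one_le_abs h0
  simpa using le_mul_of_one_le_left (abs_nonneg (ς h)) h1

/-- At most `|h|` points of `{0, …, T - 1}` leave this interval when shifted by `-h`. -/
lemma sum_shift_outside_le (T : ℕ) (h : ℤ) :
    ∑ t : Fin T, (if 0 ≤ (t.val : ℤ) - h ∧ (t.val : ℤ) - h < T then (0 : ℝ) else 1) ≤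
      |(h : ℝ)| := by
  have hcard : (Finset.univ.filter fun t : Fin T =>
      ¬ (0 ≤ (t.val : ℤ) - h ∧ (t.val : ℤ) - h < T)).card ≤ h.natAbs := by
    have hIco : h.natAbs = (if 0 ≤ h then Finset.Ico 0 h else Finset.Ico (T + h) (T : ℤ)).card := by
      split_ifs <;> simp <;> omega
    rw [hIco]
    refine Finset.card_le_card_of_injOn (fun t => (t.val : ℤ)) (fun t ht => ?_)
      (fun a _ b _ hab => Fin.ext (by simpa using hab))
    have := t.isLt
    simp only [Finset.coe_filter, Finset.mem_univ, true_and, Set.mem_ofPred_eq] at ht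
    split_ifs <;> simp <;> omega
  have habs : |(h : ℝ)| = (h.natAbs : ℝ) := by rw [Nat.cast_natAbs, Int.cast_abs]
  rw [habs]
  calc _ = ((Finset.univ.filter fun t : Fin T =>
      ¬ (0 ≤ (t.val : ℤ) - h ∧ (t.val : ℤ) - h < T)).card : ℝ) := by
        simp only [← Finset.sum_boole, ite_not]
    _ ≤ _ := by exact_mod_cast hcard

/-- The part of a convolution that is not seen by the finite Toeplitz section. -/
lemma tsum_conv_sub_section {ς b : ℤ → ℝ} (T : ℕ) (t : ℤ)
    (hs : Summable (fun h : ℤ => ς h * b (t - h))) :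
    ∑' h : ℤ, ς h * b (t - h) - ∑ s : Fin T, ς (t - s.val) * b s.val =
      ∑' h : ℤ, if 0 ≤ t - h ∧ t - h < T then 0 else ς h * b (t - h) := by
  let e : Fin T ↪ ℤ := ⟨fun s => t - s.val, fun a b hab => Fin.ext (by simpa using hab)⟩
  have he : ∀ s, e s = t - s.val := fun _ => rfl
  have hmem : ∀ h : ℤ, h ∈ Finset.univ.map e ↔ 0 ≤ t - h ∧ t - h < T := by
    intro h
    simp only [Finset.mem_map, Finset.mem_univ, true_and]
    refine ⟨?_, fun hh => ⟨⟨(t - h).toNat, by omega⟩, ?_⟩⟩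
    · rintro ⟨s, rfl⟩
      have := s.isLt
      rw [he]
      omega
    · rw [he]
      simp only
      omega
  have hsec : HasSum (fun h : ℤ => if 0 ≤ t - h ∧ t - h < T then ς h * b (t - h) else 0)
      (∑ s : Fin T, ς (t - s.val) * b s.val) := by
    have : HasSum (fun h : ℤ => if 0 ≤ t - h ∧ t - h < T then ς h * b (t - h) else 0)
        (∑ h ∈ Finset.univ.map e, if 0 ≤ t - h ∧ t - h < T then ς h * b (t - h) else 0) :=
      hasSum_sum_of_ne_finset_zero fun h hh => if_neg (mt (hmem h).2 hh)
    rw [Finset.sum_map] at this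
    simpa [he] using this
  rw [← (hs.hasSum.sub hsec).tsum_eq]
  refine tsum_congr fun h => ?_
  split_ifs <;> simp

/-- A bilinear form in a Toeplitz section differs from the one in the full convolution operator
by a quantity bounded independently of the size of the section. -/
lemma abs_conv_form_sub_toeplitz_form_le {ς a b : ℤ → ℝ} {A B : ℝ}
    (hsum : Summable (fun h : ℤ => |(h : ℝ)| * |ς h|))
    (ha : ∀ t, |a t| ≤ A) (hb : ∀ t, |b t| ≤ B) (T : ℕ) :
    |∑ t : Fin T, a t.val * ∑' h : ℤ, ς h * b (t.val - h) -
        ∑ t : Fin T, a t.val * ∑ s : Fin T, ς ((t.val : ℤ) - s.val) * b s.val| ≤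
      A * B * ∑' h : ℤ, |(h : ℝ)| * |ς h| := by
  have hA : 0 ≤ A := (abs_nonneg _).trans (ha 0)
  have hB : 0 ≤ B := (abs_nonneg _).trans (hb 0)
  have habs := summable_abs_of_summable_abs_mul hsum
  let χ : ℤ → ℤ → ℝ := fun t h => if 0 ≤ t - h ∧ t - h < T then 0 else 1
  have hχ0 : ∀ t h, 0 ≤ χ t h := fun t h => by simp only [χ]; split_ifs <;> simp
  have hχ1 : ∀ t h, χ t h ≤ 1 := fun t h => by simp only [χ]; split_ifs <;> simp
  have hconv : ∀ t : ℤ, Summable (fun h : ℤ => ς h * b (t - h)) := fun t =>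
    Summable.of_norm_bounded (habs.mul_right B) fun h => by
      rw [Real.norm_eq_abs, abs_mul]
      exact mul_le_mul_of_nonneg_left (hb _) (abs_nonneg _)
  have hχs : ∀ t : ℤ, Summable (fun h : ℤ => χ t h * |ς h|) := fun t =>
    Summable.of_nonneg_of_le (fun h => mul_nonneg (hχ0 t h) (abs_nonneg _))
      (fun h => mul_le_of_le_one_left (abs_nonneg _) (hχ1 t h)) habs
  have hterm : ∀ t : ℤ, |∑' h : ℤ, ς h * b (t - h) - ∑ s : Fin T, ς (t - s.val) * b s.val| ≤
      B * ∑' h : ℤ, χ t h * |ς h| := fun t => by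
    rw [tsum_conv_sub_section T t (hconv t), ← Real.norm_eq_abs]
    refine tsum_of_norm_bounded ((hχs t).hasSum.mul_left B) fun h => ?_
    simp only [χ]
    split_ifs
    · simp
    · rw [Real.norm_eq_abs, abs_mul, one_mul, mul_comm B]
      exact mul_le_mul_of_nonneg_left (hb _) (abs_nonneg _)
  rw [← Finset.sum_sub_distrib]
  calc _ ≤ ∑ t : Fin T, A * (B * ∑' h : ℤ, χ t.val h * |ς h|) := by
        refine (Finset.abs_sum_le_sum_abs _ _).trans (Finset.sum_le_sum fun t _ => ?_)
        rw [← mul_sub, abs_mul]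
        exact mul_le_mul (ha _) (hterm _) (abs_nonneg _) hA
    _ = A * B * ∑' h : ℤ, (∑ t : Fin T, χ t.val h) * |ς h| := by
        simp only [Finset.sum_mul]
        rw [Summable.tsum_finsetSum fun t _ => hχs _, Finset.mul_sum]
        simp only [mul_assoc]
    _ ≤ _ := by
        refine mul_le_mul_of_nonneg_left ?_ (mul_nonneg hA hB)
        have hle : ∀ h : ℤ, (∑ t : Fin T, χ t.val h) * |ς h| ≤ |(h : ℝ)| * |ς h| := fun h =>
          mul_le_mul_of_nonneg_right (sum_shift_outside_le T h) (abs_nonneg _)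
        refine Summable.tsum_le_tsum hle (Summable.of_nonneg_of_le (fun h => ?_) hle hsum) hsum
        exact mul_nonneg (Finset.sum_nonneg fun t _ => hχ0 _ _) (abs_nonneg _)

/-- Functions satisfying the cosine recurrence are eigenfunctions of convolution with an even
summable sequence. -/
lemma tsum_conv_eq_specDensity_mul {ς b : ℤ → ℝ} {B ω : ℝ} (heven : ∀ h : ℤ, ς (-h) = ς h)
    (habs : Summable (fun h : ℤ => |ς h|)) (hb : ∀ t, |b t| ≤ B)
    (hrec : ∀ t h : ℤ, b (t - h) + b (t + h) = 2 * Real.cos (h * ω) * b t) (t : ℤ) :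
    ∑' h : ℤ, ς h * b (t - h) = 2 * Real.pi * specDensity ς ω * b t := by
  have hconv : Summable (fun h : ℤ => ς h * b (t - h)) :=
    Summable.of_norm_bounded (habs.mul_right B) fun h => by
      rw [Real.norm_eq_abs, abs_mul]
      exact mul_le_mul_of_nonneg_left (hb _) (abs_nonneg _)
  have hneg : HasSum (fun h : ℤ => ς h * b (t + h)) (∑' h : ℤ, ς h * b (t - h)) := by
    have := (Equiv.neg ℤ).hasSum_iff.2 hconv.hasSum
    simpa [Function.comp_def, heven] using this
  have hadd := (hconv.hasSum.add hneg).tsum_eq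
  have hcos : (fun h : ℤ => ς h * b (t - h) + ς h * b (t + h)) =
      fun h : ℤ => ς h * Real.cos (h * ω) * (2 * b t) := by
    ext h
    linear_combination ς h * hrec t h
  rw [hcos, tsum_mul_right] at hadd
  have hpi := Real.pi_ne_zero
  rw [specDensity]
  field_simp
  linarith

lemma sum_exp_fourier_eq_zero {T : ℕ} (hT : T ≠ 0) {k : ℤ} (hk : ¬ (T : ℤ) ∣ k) :
    ∑ t : Fin T, Complex.exp (((t.val : ℝ) * (2 * Real.pi * k / T) : ℝ) * Complex.I) = 0 := by
  have hT' : (T : ℂ) ≠ 0 := Nat.cast_ne_zero.2 hT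
  have hpi : (Real.pi : ℂ) ≠ 0 := by exact_mod_cast Real.pi_ne_zero
  set z : ℂ := Complex.exp (2 * Real.pi * k / T * Complex.I) with hz
  have hz1 : z ≠ 1 := by
    intro h
    obtain ⟨n, hn⟩ := Complex.exp_eq_one_iff.1 h
    refine hk ⟨n, ?_⟩
    have hI := Complex.I_ne_zero
    field_simp at hn
    exact_mod_cast hn
  have hzT : z ^ T = 1 := by
    rw [hz, ← Complex.exp_nat_mul, Complex.exp_eq_one_iff]
    exact ⟨k, by field_simp⟩
  have hpow : ∀ t : ℕ,
      Complex.exp (((t : ℝ) * (2 * Real.pi * k / T) : ℝ) * Complex.I) = z ^ t := fun t => by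
    rw [hz, ← Complex.exp_nat_mul]
    congr 1
    push_cast
    ring
  simp only [hpow]
  rw [Fin.sum_univ_eq_sum_range (fun t => z ^ t), geom_sum_eq hz1, hzT]
  simp

lemma sum_cos_fourier_eq_zero {T : ℕ} (hT : T ≠ 0) {k : ℤ} (hk : ¬ (T : ℤ) ∣ k) :
    ∑ t : Fin T, Real.cos ((t.val : ℝ) * (2 * Real.pi * k / T)) = 0 := by
  have := congrArg Complex.re (sum_exp_fourier_eq_zero hT hk)
  simpa only [Complex.re_sum, Complex.exp_ofReal_mul_I_re, Complex.zero_re] using this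

lemma sum_sin_fourier_eq_zero {T : ℕ} (hT : T ≠ 0) (k : ℤ) :
    ∑ t : Fin T, Real.sin ((t.val : ℝ) * (2 * Real.pi * k / T)) = 0 := by
  by_cases hk : (T : ℤ) ∣ k
  · obtain ⟨n, rfl⟩ := hk
    have hT' : (T : ℝ) ≠ 0 := Nat.cast_ne_zero.2 hT
    refine Finset.sum_eq_zero fun t _ => ?_
    rw [Real.sin_eq_zero_iff]
    exact ⟨2 * t.val * n, by push_cast; field_simp⟩
  · have := congrArg Complex.im (sum_exp_fourier_eq_zero hT hk)
    simpa only [Complex.im_sum, Complex.exp_ofReal_mul_I_im, Complex.zero_im] using this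

/-- The `p`-th row of `trigBasisMat m`, extended to a function on the integers. -/
noncomputable def trigMode (m p : ℕ) (x : ℤ) : ℝ :=
  if p = 0 then Real.sqrt (1 / (2 * m + 1))
  else if p % 2 = 1 then
    Real.sqrt (2 / (2 * m + 1)) *
      Real.cos ((x : ℝ) * (2 * Real.pi * (((p + 1) / 2 : ℕ) : ℝ) / (2 * m + 1)))
  else
    Real.sqrt (2 / (2 * m + 1)) *
      Real.sin ((x : ℝ) * (2 * Real.pi * ((p / 2 : ℕ) : ℝ) / (2 * m + 1)))

lemma trigBasisMat_apply (m : ℕ) (p t : Fin (2 * m + 1)) :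
    trigBasisMat m p t = trigMode m p.val t.val := by
  simp [trigBasisMat, trigMode]

lemma trigMode_zero (m : ℕ) (x : ℤ) : trigMode m 0 x = Real.sqrt (1 / (2 * m + 1)) := by
  simp [trigMode]

lemma trigMode_odd (m j : ℕ) (x : ℤ) : trigMode m (2 * j + 1) x =
    Real.sqrt (2 / (2 * m + 1)) *
      Real.cos ((x : ℝ) * (2 * Real.pi * ((j + 1 : ℕ) : ℝ) / (2 * m + 1))) := by
  have h1 : (2 * j + 1) % 2 = 1 := by omega
  have h2 : (2 * j + 1 + 1) / 2 = j + 1 := by omega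
  simp only [trigMode, h1, h2, if_true, Nat.add_eq_zero_iff, one_ne_zero, and_false, if_false]

lemma trigMode_even (m j : ℕ) (x : ℤ) : trigMode m (2 * j + 2) x =
    Real.sqrt (2 / (2 * m + 1)) *
      Real.sin ((x : ℝ) * (2 * Real.pi * ((j + 1 : ℕ) : ℝ) / (2 * m + 1))) := by
  have h1 : (2 * j + 2) % 2 = 0 := by omega
  have h2 : (2 * j + 2) / 2 = j + 1 := by omega
  simp [trigMode, h1, h2]

lemma eq_zero_or_odd_or_even (p : ℕ) : p = 0 ∨ (∃ j, p = 2 * j + 1) ∨ ∃ j, p = 2 * j + 2 := by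
  rcases Nat.even_or_odd' p with ⟨c, rfl | rfl⟩
  · rcases c with _ | j
    · simp
    · exact Or.inr (Or.inr ⟨j, by ring⟩)
  · exact Or.inr (Or.inl ⟨c, rfl⟩)

lemma abs_trigMode_le (m p : ℕ) (x : ℤ) : |trigMode m p x| ≤ Real.sqrt (2 / (2 * m + 1)) := by
  rcases eq_zero_or_odd_or_even p with rfl | ⟨j, rfl⟩ | ⟨j, rfl⟩
  · rw [trigMode_zero, abs_of_nonneg (Real.sqrt_nonneg _)]
    gcongr
    norm_num
  · rw [trigMode_odd, abs_mul, abs_of_nonneg (Real.sqrt_nonneg _)]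
    exact mul_le_of_le_one_right (Real.sqrt_nonneg _) (Real.abs_cos_le_one _)
  · rw [trigMode_even, abs_mul, abs_of_nonneg (Real.sqrt_nonneg _)]
    exact mul_le_of_le_one_right (Real.sqrt_nonneg _) (Real.abs_sin_le_one _)

lemma trigMode_sub_add_trigMode_add (m p : ℕ) (t h : ℤ) :
    trigMode m p (t - h) + trigMode m p (t + h) =
      2 * Real.cos (h * (2 * Real.pi * (((p + 1) / 2 : ℕ) : ℝ) / (2 * m + 1))) *
        trigMode m p t := by
  rcases eq_zero_or_odd_or_even p with rfl | ⟨j, rfl⟩ | ⟨j, rfl⟩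
  · simp [trigMode_zero]
    ring
  · have h2 : (2 * j + 1 + 1) / 2 = j + 1 := by omega
    simp only [trigMode_odd, h2, Int.cast_sub, Int.cast_add, sub_mul, add_mul, Real.cos_add,
      Real.cos_sub]
    ring
  · have h2 : (2 * j + 2 + 1) / 2 = j + 1 := by omega
    simp only [trigMode_even, h2, Int.cast_sub, Int.cast_add, sub_mul, add_mul, Real.sin_add,
      Real.sin_sub]
    ring

section Orthogonality

variable {T : ℕ} (j k : ℕ)

lemma sum_cos_mul_cos_fourier :
    ∑ t : Fin T, Real.cos ((t.val : ℝ) * (2 * Real.pi * j / T)) *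
        Real.cos ((t.val : ℝ) * (2 * Real.pi * k / T)) =
      (∑ t : Fin T, Real.cos ((t.val : ℝ) * (2 * Real.pi * ((j - k : ℤ) : ℤ) / T)) +
        ∑ t : Fin T, Real.cos ((t.val : ℝ) * (2 * Real.pi * ((j + k : ℤ) : ℤ) / T))) / 2 := by
  rw [← Finset.sum_add_distrib, Finset.sum_div]
  refine Finset.sum_congr rfl fun t _ => ?_
  have hs : (t.val : ℝ) * (2 * Real.pi * ((j - k : ℤ) : ℤ) / T) =
      t.val * (2 * Real.pi * j / T) - t.val * (2 * Real.pi * k / T) := by push_cast; ring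
  have ha : (t.val : ℝ) * (2 * Real.pi * ((j + k : ℤ) : ℤ) / T) =
      t.val * (2 * Real.pi * j / T) + t.val * (2 * Real.pi * k / T) := by push_cast; ring
  rw [hs, ha, Real.cos_sub, Real.cos_add]
  ring

lemma sum_sin_mul_sin_fourier :
    ∑ t : Fin T, Real.sin ((t.val : ℝ) * (2 * Real.pi * j / T)) *
        Real.sin ((t.val : ℝ) * (2 * Real.pi * k / T)) =
      (∑ t : Fin T, Real.cos ((t.val : ℝ) * (2 * Real.pi * ((j - k : ℤ) : ℤ) / T)) -
        ∑ t : Fin T, Real.cos ((t.val : ℝ) * (2 * Real.pi * ((j + k : ℤ) : ℤ) / T))) / 2 := by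
  rw [← Finset.sum_sub_distrib, Finset.sum_div]
  refine Finset.sum_congr rfl fun t _ => ?_
  have hs : (t.val : ℝ) * (2 * Real.pi * ((j - k : ℤ) : ℤ) / T) =
      t.val * (2 * Real.pi * j / T) - t.val * (2 * Real.pi * k / T) := by push_cast; ring
  have ha : (t.val : ℝ) * (2 * Real.pi * ((j + k : ℤ) : ℤ) / T) =
      t.val * (2 * Real.pi * j / T) + t.val * (2 * Real.pi * k / T) := by push_cast; ring
  rw [hs, ha, Real.cos_sub, Real.cos_add]
  ring

lemma sum_sin_mul_cos_fourier (hT : T ≠ 0) :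
    ∑ t : Fin T, Real.sin ((t.val : ℝ) * (2 * Real.pi * j / T)) *
        Real.cos ((t.val : ℝ) * (2 * Real.pi * k / T)) = 0 := by
  have h : ∑ t : Fin T, Real.sin ((t.val : ℝ) * (2 * Real.pi * j / T)) *
        Real.cos ((t.val : ℝ) * (2 * Real.pi * k / T)) =
      (∑ t : Fin T, Real.sin ((t.val : ℝ) * (2 * Real.pi * ((j - k : ℤ) : ℤ) / T)) +
        ∑ t : Fin T, Real.sin ((t.val : ℝ) * (2 * Real.pi * ((j + k : ℤ) : ℤ) / T))) / 2 := by
    rw [← Finset.sum_add_distrib, Finset.sum_div]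
    refine Finset.sum_congr rfl fun t _ => ?_
    have hs : (t.val : ℝ) * (2 * Real.pi * ((j - k : ℤ) : ℤ) / T) =
        t.val * (2 * Real.pi * j / T) - t.val * (2 * Real.pi * k / T) := by push_cast; ring
    have ha : (t.val : ℝ) * (2 * Real.pi * ((j + k : ℤ) : ℤ) / T) =
        t.val * (2 * Real.pi * j / T) + t.val * (2 * Real.pi * k / T) := by push_cast; ring
    rw [hs, ha, Real.sin_sub, Real.sin_add]
    ring
  rw [h, sum_sin_fourier_eq_zero hT, sum_sin_fourier_eq_zero hT]
  simp

variable {j k}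

lemma not_dvd_add_of_lt (hj : 0 < j) (hjT : 2 * j < T) (hkT : 2 * k < T) :
    ¬ (T : ℤ) ∣ (j + k : ℤ) := fun hd => by
  have := Int.le_of_dvd (by omega) hd
  omega

lemma sum_cos_sub_fourier (hjT : 2 * j < T) (hkT : 2 * k < T) :
    ∑ t : Fin T, Real.cos ((t.val : ℝ) * (2 * Real.pi * ((j - k : ℤ) : ℤ) / T)) =
      if j = k then (T : ℝ) else 0 := by
  split_ifs with h
  · simp [h]
  · refine sum_cos_fourier_eq_zero (by omega) fun hd => h ?_
    have := Int.eq_zero_of_abs_lt_dvd hd (by rw [abs_lt]; omega)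
    omega

end Orthogonality

lemma sum_trigMode_mul_trigMode {m p q : ℕ} (hp : p < 2 * m + 1) (hq : q < 2 * m + 1) :
    ∑ t : Fin (2 * m + 1), trigMode m p t.val * trigMode m q t.val = if p = q then 1 else 0 := by
  wlog hpq : q ≤ p generalizing p q
  · simpa only [mul_comm, eq_comm] using this hq hp (le_of_not_ge hpq)
  have hT : 2 * m + 1 ≠ 0 := by omega
  have hT' : (2 * (m : ℝ) + 1) ≠ 0 := by positivity
  have hcast : (2 * (m : ℝ) + 1) = ((2 * m + 1 : ℕ) : ℝ) := by push_cast; rfl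
  have h1 : Real.sqrt (1 / (2 * m + 1)) * Real.sqrt (1 / (2 * m + 1)) = 1 / (2 * m + 1) :=
    Real.mul_self_sqrt (by positivity)
  have h2 : ∀ a b : ℝ, Real.sqrt (2 / (2 * m + 1)) * a * (Real.sqrt (2 / (2 * m + 1)) * b) =
      2 / (2 * m + 1) * (a * b) := fun a b => by
    rw [mul_mul_mul_comm, Real.mul_self_sqrt (by positivity)]
  rcases eq_zero_or_odd_or_even p with rfl | ⟨j, rfl⟩ | ⟨j, rfl⟩ <;>
    rcases eq_zero_or_odd_or_even q with rfl | ⟨k, rfl⟩ | ⟨k, rfl⟩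
  · simp only [trigMode_zero, h1]
    simp
    field_simp
  · omega
  · omega
  · have h := sum_cos_fourier_eq_zero hT (k := (j + 1 : ℕ))
      (fun hd => by have := Int.le_of_dvd (by omega) hd; omega)
    simp only [trigMode_zero, trigMode_odd, Int.cast_natCast] at h ⊢
    rw [← Finset.sum_mul, ← Finset.mul_sum, hcast, h]
    simp
  · simp only [trigMode_odd, Int.cast_natCast, h2]
    rw [← Finset.mul_sum, hcast, sum_cos_mul_cos_fourier,
      sum_cos_sub_fourier (by omega) (by omega),
      sum_cos_fourier_eq_zero hT (not_dvd_add_of_lt (by omega) (by omega) (by omega)), ← hcast]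
    by_cases hjk : j = k <;> simp [hjk, hT']
  · simp only [trigMode_odd, trigMode_even, Int.cast_natCast, h2]
    simp only [mul_comm (Real.cos _)]
    rw [← Finset.mul_sum, hcast, sum_sin_mul_cos_fourier _ _ hT, if_neg (by omega), mul_zero]
  · have h := sum_sin_fourier_eq_zero hT (j + 1 : ℕ)
    simp only [trigMode_zero, trigMode_even, Int.cast_natCast] at h ⊢
    rw [← Finset.sum_mul, ← Finset.mul_sum, hcast, h]
    simp
  · simp only [trigMode_odd, trigMode_even, Int.cast_natCast, h2]
    rw [← Finset.mul_sum, hcast, sum_sin_mul_cos_fourier _ _ hT, if_neg (by omega), mul_zero]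
  · simp only [trigMode_even, Int.cast_natCast, h2]
    rw [← Finset.mul_sum, hcast, sum_sin_mul_sin_fourier,
      sum_cos_sub_fourier (by omega) (by omega),
      sum_cos_fourier_eq_zero hT (not_dvd_add_of_lt (by omega) (by omega) (by omega)), ← hcast]
    by_cases hjk : j = k <;> simp [hjk, hT']

/-- Lemma E.1, odd `T = 2m+1 ≥ 3`: if `ς : ℤ → ℝ` is even with
`Σ_{h≥1} h|ς(h)| < ∞`, then there is a constant `K` (depending only on `ς`) such that
for all odd `T = 2m+1 ≥ 3` and all indices `p, q`,
`|(P_T C_T P_Tᵀ − 2π G_T)_{pq}| ≤ K/T`. -/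
theorem toeplitz_diagonalization_error (ς : ℤ → ℝ)
    (heven : ∀ h : ℤ, ς (-h) = ς h)
    (hsum : Summable (fun h : ℕ => (h : ℝ) * |ς (h : ℤ)|)) :
    ∃ K : ℝ, ∀ m : ℕ, 1 ≤ m → ∀ p q : Fin (2 * m + 1),
      |(trigBasisMat m * toeplitzMat ς m * (trigBasisMat m)ᵀ -
          (2 * Real.pi) • specDiagMat ς m) p q| ≤ K / (2 * m + 1) := by
  have hsum' := summable_int_abs_mul_of_even heven hsum
  refine ⟨2 * ∑' h : ℤ, |(h : ℝ)| * |ς h|, fun m _ p q => ?_⟩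
  have hform : (trigBasisMat m * toeplitzMat ς m * (trigBasisMat m)ᵀ) p q =
      ∑ t : Fin (2 * m + 1), trigMode m p.val t.val *
        ∑ s : Fin (2 * m + 1), ς ((t.val : ℤ) - s.val) * trigMode m q.val s.val := by
    rw [Matrix.mul_assoc]
    simp only [Matrix.mul_apply, Matrix.transpose_apply, trigBasisMat_apply,
      toeplitzMat]
  have hdiag : ((2 * Real.pi) • specDiagMat ς m) p q =
      ∑ t : Fin (2 * m + 1), trigMode m p.val t.val *
        ∑' h : ℤ, ς h * trigMode m q.val (t.val - h) := by
    simp only [tsum_conv_eq_specDensity_mul heven (summable_abs_of_summable_abs_mul hsum')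
      (abs_trigMode_le m q.val) (trigMode_sub_add_trigMode_add m q.val),
      mul_left_comm _ (2 * Real.pi * specDensity _ _)]
    rw [← Finset.mul_sum, sum_trigMode_mul_trigMode p.isLt q.isLt]
    by_cases hpq : p = q
    · simp [specDiagMat, hpq]
    · simp [specDiagMat, hpq, Fin.val_inj]
  rw [Matrix.sub_apply, abs_sub_comm, hform, hdiag]
  refine (abs_conv_form_sub_toeplitz_form_le hsum' (abs_trigMode_le m p.val)
    (abs_trigMode_le m q.val) (2 * m + 1)).trans_eq ?_
  rw [Real.mul_self_sqrt (by positivity)]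
  ring
end

section
/- Let A be an invertible m₁×m₁ real matrix, C an invertible m₂×m₂ real matrix, B an m₁×m₂ real matrix such that C⁻¹ + BᵀA⁻¹B is invertible, and D an m₁×m₃ real matrix. Set E := B·C·Bᵀ + A (which is invertible). Then ‖Dᵀ·E⁻¹·B‖ ≤ ‖Dᵀ·A⁻¹·B‖ · ‖(C⁻¹ + BᵀA⁻¹B)⁻¹‖ · ‖C⁻¹‖. -/
open Matrix

/-- The Frobenius norm `‖M‖ = √(trace (Mᵀ M))` of a real matrix. -/
noncomputable def frob {m n : ℕ} (M : Matrix (Fin m) (Fin n) ℝ) : ℝ :=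
  Real.sqrt (Matrix.trace (Mᵀ * M))

section Woodbury

variable {m n R : Type*} [Fintype m] [DecidableEq m] [Fintype n] [DecidableEq n] [CommRing R]
  {A : Matrix m m R} {U : Matrix m n R} {C : Matrix n n R} {V : Matrix n m R}

theorem isUnit_det_mul_mul_add (hA : IsUnit A.det) (hC : IsUnit C.det)
    (hK : IsUnit (C⁻¹ + V * A⁻¹ * U).det) : IsUnit (U * C * V + A).det := by
  let := A.invertibleOfIsUnitDet hA
  let := C.invertibleOfIsUnitDet hC
  rw [← invOf_eq_nonsing_inv, ← invOf_eq_nonsing_inv] at hK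
  let := (⅟C + V * ⅟A * U).invertibleOfIsUnitDet hK
  let := invertibleAddMulMul A U C V
  rw [add_comm]
  exact isUnit_det_of_invertible _

/-- The push-through form of the Woodbury identity. -/
theorem inv_mul_mul_add_mul (hA : IsUnit A.det) (hC : IsUnit C.det)
    (hK : IsUnit (C⁻¹ + V * A⁻¹ * U).det) :
    (U * C * V + A)⁻¹ * U = A⁻¹ * U * (C⁻¹ + V * A⁻¹ * U)⁻¹ * C⁻¹ := by
  have hE := isUnit_det_mul_mul_add hA hC hK
  have key : (U * C * V + A) * (A⁻¹ * U) = U * (C * (C⁻¹ + V * A⁻¹ * U)) := by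
    rw [Matrix.add_mul, mul_nonsing_inv_cancel_left A U hA, Matrix.mul_add,
      mul_nonsing_inv C hC, Matrix.mul_add, Matrix.mul_one, add_comm]
    simp only [Matrix.mul_assoc]
  have push : A⁻¹ * U = (U * C * V + A)⁻¹ * U * C * (C⁻¹ + V * A⁻¹ * U) := by
    rw [← nonsing_inv_mul_cancel_left _ (A⁻¹ * U) hE, key]
    simp only [Matrix.mul_assoc]
  calc (U * C * V + A)⁻¹ * U
      = (U * C * V + A)⁻¹ * U * C * (C⁻¹ + V * A⁻¹ * U) * (C⁻¹ + V * A⁻¹ * U)⁻¹ * C⁻¹ := by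
        rw [mul_nonsing_inv_cancel_right _ _ hK, mul_nonsing_inv_cancel_right _ _ hC]
    _ = A⁻¹ * U * (C⁻¹ + V * A⁻¹ * U)⁻¹ * C⁻¹ := by rw [← push]

end Woodbury

section Frobenius

attribute [local instance] Matrix.frobeniusNormedAddCommGroup

theorem frob_eq_norm {m n : ℕ} (M : Matrix (Fin m) (Fin n) ℝ) : frob M = ‖M‖ := by
  rw [frob, frobenius_norm_def, Real.sqrt_eq_rpow, Finset.sum_comm]
  simp [Matrix.trace, Matrix.mul_apply, sq]

theorem frob_nonneg {m n : ℕ} (M : Matrix (Fin m) (Fin n) ℝ) : 0 ≤ frob M :=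
  Real.sqrt_nonneg _

theorem frob_mul_le {l m n : ℕ} (M : Matrix (Fin l) (Fin m) ℝ) (N : Matrix (Fin m) (Fin n) ℝ) :
    frob (M * N) ≤ frob M * frob N := by
  simpa only [frob_eq_norm] using frobenius_norm_mul M N

end Frobenius

/-- deterministic inequality behind Lemma A.1(ii)–(iii): with
`E := B·C·Bᵀ + A` invertible,
`‖Dᵀ E⁻¹ B‖ ≤ ‖Dᵀ A⁻¹ B‖ · ‖(C⁻¹ + Bᵀ A⁻¹ B)⁻¹‖ · ‖C⁻¹‖` in Frobenius norm. -/
theorem DtEinvB_norm_bound {m₁ m₂ m₃ : ℕ}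
    (A : Matrix (Fin m₁) (Fin m₁) ℝ) (C : Matrix (Fin m₂) (Fin m₂) ℝ)
    (B : Matrix (Fin m₁) (Fin m₂) ℝ) (D : Matrix (Fin m₁) (Fin m₃) ℝ)
    (hA : IsUnit A.det) (hC : IsUnit C.det)
    (hK : IsUnit (C⁻¹ + Bᵀ * A⁻¹ * B).det) :
    IsUnit (B * C * Bᵀ + A).det ∧
      frob (Dᵀ * (B * C * Bᵀ + A)⁻¹ * B) ≤
        frob (Dᵀ * A⁻¹ * B) * frob ((C⁻¹ + Bᵀ * A⁻¹ * B)⁻¹) * frob (C⁻¹) := by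
  refine ⟨isUnit_det_mul_mul_add hA hC hK, ?_⟩
  rw [Matrix.mul_assoc, inv_mul_mul_add_mul hA hC hK, ← Matrix.mul_assoc, ← Matrix.mul_assoc,
    ← Matrix.mul_assoc]
  exact (frob_mul_le _ _).trans
    (mul_le_mul_of_nonneg_right (frob_mul_le _ _) (frob_nonneg _))
end
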